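/- Fix d ≥ 2, 0 < p⋆ ≤ 1/(2(d+1)), and η ∈ Δ_d, and let X₁,…,X_m be a trajectory drawn from (M_η, p). Let N_{d+1} = ∑_{t=1}^m 1{X_t = d+1}. Then for every n ≥ 1 and every m < n/(2p⋆): P_{M_η,p}( N_{d+1} < n ) ≥ 1/5. -/

import Mathlib

open Finset

noncomputable section

/-- A row-stochastic matrix. -/
def IsStochastic {d : ℕ} (M : Matrix (Fin d) (Fin d) ℝ) : Prop :=
  (∀ i j, 0 ≤ M i j) ∧ ∀ i, ∑ j, M i j = 1

/-- A probability distribution on `Fin d`. -/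
def IsDist {d : ℕ} (μ : Fin d → ℝ) : Prop :=
  (∀ i, 0 ≤ μ i) ∧ ∑ i, μ i = 1

/-- Probability of a length-`m` trajectory under the Markov chain `(M, μ)`:
`μ(x₁) ∏_{t=1}^{m-1} M(x_t, x_{t+1})`. -/
def trajP {d m : ℕ} (M : Matrix (Fin d) (Fin d) ℝ) (μ : Fin d → ℝ)
    (x : Fin m → Fin d) : ℝ :=
  (if h : 0 < m then μ (x ⟨0, h⟩) else 1) *
    ∏ t : Fin (m - 1),
      M (x ⟨t.1, by have h2 := t.2; omega⟩) (x ⟨t.1 + 1, by have h2 := t.2; omega⟩)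


/-- The distribution `p` on `[d+1]`: `p(d+1) = p⋆`, `p(i) = (1-p⋆)/d` for `i ∈ [d]`. -/
def pInit (d : ℕ) (ps : ℝ) : Fin (d + 1) → ℝ :=
  fun i => if i.1 = d then ps else (1 - ps) / d

/-- The chain `M_η ∈ G_{p⋆}`: rows `1,…,d` equal `p`, row `d+1` is `(η(1),…,η(d),0)`. -/
def MG (d : ℕ) (ps : ℝ) (η : Fin d → ℝ) : Matrix (Fin (d + 1)) (Fin (d + 1)) ℝ :=
  Matrix.of fun i j =>
    if i.1 = d then (if h : j.1 = d then 0 else η ⟨j.1, by have h2 := j.2; omega⟩)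
    else pInit d ps j

/-- Number of visits to state `d+1` in a trajectory. -/
def Nlast (d m : ℕ) (x : Fin m → Fin (d + 1)) : ℕ :=
  (Finset.univ.filter (fun t => (x t).1 = d)).card

/-- First-step decomposition of the probability of a trajectory. -/
theorem trajP_cons {d m : ℕ} (M : Matrix (Fin d) (Fin d) ℝ) (μ : Fin d → ℝ) (a : Fin d)
    (x : Fin m → Fin d) :
    trajP M μ (Fin.cons a x : Fin (m + 1) → Fin d) = μ a * trajP M (M a) x := by
  cases m with
  | zero => simp [trajP]
  | succ k =>
    simp only [trajP, Nat.succ_pos, dite_true]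
    change μ a * (∏ t : Fin (k + 1), M _ _) = μ a * (M a (x 0) * ∏ t : Fin k, M _ _)
    rw [Fin.prod_univ_succ]
    rfl

theorem sum_fin_cons {α : Type*} [Fintype α] {m : ℕ} (f : (Fin (m + 1) → α) → ℝ) :
    ∑ x, f x = ∑ a, ∑ x : Fin m → α, f (Fin.cons a x) := by
  rw [← (Fin.consEquiv fun _ => α).sum_comp, Fintype.sum_prod_type]
  rfl

theorem trajP_nonneg {d m : ℕ} {M : Matrix (Fin d) (Fin d) ℝ} (hM : IsStochastic M)
    {μ : Fin d → ℝ} (hμ : IsDist μ) (x : Fin m → Fin d) : 0 ≤ trajP M μ x := by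
  unfold trajP
  refine mul_nonneg ?_ (prod_nonneg fun _ _ => hM.1 _ _)
  split_ifs
  · exact hμ.1 _
  · exact zero_le_one

theorem IsStochastic.isDist_row {d : ℕ} {M : Matrix (Fin d) (Fin d) ℝ} (hM : IsStochastic M)
    (a : Fin d) : IsDist (M a) :=
  ⟨hM.1 a, hM.2 a⟩

theorem sum_trajP {d : ℕ} {M : Matrix (Fin d) (Fin d) ℝ} (hM : IsStochastic M) (m : ℕ)
    {μ : Fin d → ℝ} (hμ : IsDist μ) : ∑ x : Fin m → Fin d, trajP M μ x = 1 := by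
  induction m generalizing μ with
  | zero => simp [trajP]
  | succ k ih =>
    simp_rw [sum_fin_cons, trajP_cons, ← mul_sum, ih (hM.isDist_row _), mul_one, hμ.2]

theorem Nlast_cons (d m : ℕ) (a : Fin (d + 1)) (x : Fin m → Fin (d + 1)) :
    Nlast d (m + 1) (Fin.cons a x) = (if a.1 = d then 1 else 0) + Nlast d m x := by
  simp only [Nlast, card_filter, Fin.sum_univ_succ, Fin.cons_zero, Fin.cons_succ]

/-- If every one-step probability of entering the last state is at most `q`, the expected number
of visits to it in `m` steps is at most `m * q`. -/
theorem sum_Nlast_mul_trajP_le {d : ℕ} {M : Matrix (Fin (d + 1)) (Fin (d + 1)) ℝ}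
    (hM : IsStochastic M) {q : ℝ} (hMq : ∀ i, M i (Fin.last d) ≤ q) (m : ℕ)
    {μ : Fin (d + 1) → ℝ} (hμ : IsDist μ) (hμq : μ (Fin.last d) ≤ q) :
    ∑ x : Fin m → Fin (d + 1), (Nlast d m x : ℝ) * trajP M μ x ≤ m * q := by
  induction m generalizing μ with
  | zero => simp [Nlast]
  | succ k ih =>
    have step (a : Fin (d + 1)) :
        ∑ x : Fin k → Fin (d + 1),
            (Nlast d (k + 1) (Fin.cons a x) : ℝ) * trajP M μ (Fin.cons a x : Fin (k + 1) → _) =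
          (if a = Fin.last d then μ a else 0) +
            μ a * ∑ x : Fin k → Fin (d + 1), (Nlast d k x : ℝ) * trajP M (M a) x := by
      have hlast : a.1 = d ↔ a = Fin.last d := by simp [Fin.ext_iff]
      simp_rw [Nlast_cons, trajP_cons, hlast]
      push_cast
      simp_rw [add_mul, sum_add_distrib, mul_left_comm _ (μ a), ← mul_sum,
        sum_trajP hM k (hM.isDist_row a)]
      split_ifs <;> simp
    calc _ = ∑ a, ((if a = Fin.last d then μ a else 0) +
            μ a * ∑ x : Fin k → Fin (d + 1), (Nlast d k x : ℝ) * trajP M (M a) x) := by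
          rw [sum_fin_cons]
          exact sum_congr rfl fun a _ => step a
      _ ≤ ∑ a, ((if a = Fin.last d then μ a else 0) + μ a * (k * q)) := by
          gcongr with a
          · exact hμ.1 a
          · exact ih (hM.isDist_row a) (hMq a)
      _ = μ (Fin.last d) + k * q := by
          rw [sum_add_distrib, ← sum_mul, hμ.2]
          simp
      _ ≤ (k + 1 : ℕ) * q := by
          push_cast
          linarith

theorem isDist_pInit {d : ℕ} (hd : d ≠ 0) {ps : ℝ} (h0 : 0 ≤ ps) (h1 : ps ≤ 1) :
    IsDist (pInit d ps) := by
  have hd' : (d : ℝ) ≠ 0 := Nat.cast_ne_zero.mpr hd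
  refine ⟨fun i => ?_, ?_⟩
  · unfold pInit
    split_ifs
    · exact h0
    · exact div_nonneg (sub_nonneg.mpr h1) d.cast_nonneg
  · have hne (i : Fin d) : i.1 ≠ d := i.2.ne
    simp [Fin.sum_univ_castSucc, pInit, hne]
    field_simp
    ring

theorem isStochastic_MG {d : ℕ} (hd : d ≠ 0) {ps : ℝ} (h0 : 0 ≤ ps) (h1 : ps ≤ 1)
    {η : Fin d → ℝ} (hη : IsDist η) : IsStochastic (MG d ps η) := by
  have hp := isDist_pInit hd h0 h1
  refine ⟨fun i j => ?_, fun i => ?_⟩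
  · simp only [MG, Matrix.of_apply]
    split_ifs
    · exact le_rfl
    · exact hη.1 _
    · exact hp.1 j
  · by_cases hi : i.1 = d
    · have hne (i : Fin d) : i.1 ≠ d := i.2.ne
      simpa [MG, hi, Fin.sum_univ_castSucc, hne] using hη.2
    · simpa [MG, hi] using hp.2

theorem MG_last_le {d : ℕ} {ps : ℝ} (h0 : 0 ≤ ps) (η : Fin d → ℝ) (i : Fin (d + 1)) :
    MG d ps η i (Fin.last d) ≤ ps := by
  by_cases hi : i.1 = d <;> simp [MG, pInit, hi, h0]

/-- For a chain `M_η ∈ G_{p⋆}` started from `p`, if `m < n/(2p⋆)` then with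
probability at least `1/5` the trajectory visits state `d+1` fewer than `n` times. -/
theorem few_visits_to_last_state
    (d m : ℕ) (hd : 2 ≤ d) (ps : ℝ) (hps : 0 < ps) (hps2 : ps ≤ 1 / (2 * ((d : ℝ) + 1)))
    (η : Fin d → ℝ) (hη : IsDist η) (n : ℕ) (hn : 1 ≤ n)
    (hm : (m : ℝ) < (n : ℝ) / (2 * ps)) :
    (1 : ℝ) / 5 ≤
      ∑ x ∈ Finset.univ.filter (fun x : Fin m → Fin (d + 1) => Nlast d m x < n),
        trajP (MG d ps η) (pInit d ps) x := by
  have h1 : ps ≤ 1 := hps2.trans <| by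
    rw [div_le_one (by positivity)]
    linarith [(Nat.cast_nonneg d : (0 : ℝ) ≤ d)]
  have hd0 : d ≠ 0 := by omega
  have hp := isDist_pInit hd0 hps.le h1
  have hM := isStochastic_MG hd0 hps.le h1 hη
  have hE := sum_Nlast_mul_trajP_le hM (MG_last_le hps.le η) m hp (by simp [pInit])
  have hT := sum_trajP hM m hp
  rw [← sum_filter_add_sum_filter_not univ (fun x => Nlast d m x < n)] at hT
  have hmarkov : (n : ℝ) * ∑ x ∈ univ.filter (fun x : Fin m → Fin (d + 1) => ¬Nlast d m x < n),
      trajP (MG d ps η) (pInit d ps) x ≤ m * ps := by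
    refine le_trans ?_ hE
    rw [mul_sum]
    refine (sum_le_sum fun x hx => ?_).trans <|
      sum_le_sum_of_subset_of_nonneg (filter_subset _ _) fun x _ _ =>
        mul_nonneg (Nat.cast_nonneg _) (trajP_nonneg hM hp x)
    have hx : n ≤ Nlast d m x := not_lt.mp (mem_filter.mp hx).2
    exact mul_le_mul_of_nonneg_right (Nat.cast_le.mpr hx) (trajP_nonneg hM hp x)
  rw [lt_div_iff₀ (by positivity)] at hm
  have hn0 : (0 : ℝ) < n := Nat.cast_pos.mpr hn
  by_contra! h
  nlinarith

end
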